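/- Let 1 < p < ∞. The space 𝓜_p fails the upper Pythagorean inequality for every exponent r > 1 and constant K > 0: for every r > 1 and K > 0 there exist x, y ∈ 𝓜_p with x ⊥_{𝓜_p} y (Birkhoff–James orthogonality) and ‖x‖_{𝓜_p}^r + K‖y‖_{𝓜_p}^r < ‖x+y‖_{𝓜_p}^r; witnesses are x = 1 and y = cz for suitable c ≠ 0. -/

import Mathlib

open ComplexConjugate
open scoped ENNReal

noncomputable section

/-- Cauchy product of coefficient sequences (multiplication of power series). -/
def cauchyMul (f g : ℕ → ℂ) : ℕ → ℂ :=
  fun n => ∑ k ∈ Finset.range (n + 1), f k * g (n - k)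

/-- Membership in `ℓᵖ_A`: the coefficient sequence is `p`-summable (`p` finite). -/
def MemLpA (p : ℝ) (f : ℕ → ℂ) : Prop :=
  Summable fun k => ‖f k‖ ^ p

/-- The `ℓᵖ` norm of a coefficient sequence (`p` finite). -/
def pNorm (p : ℝ) (f : ℕ → ℂ) : ℝ :=
  (∑' k, ‖f k‖ ^ p) ^ (1 / p)

/-- `φ` is a multiplier of `ℓᵖ_A`. -/
def IsMultiplier (p : ℝ) (φ : ℕ → ℂ) : Prop :=
  ∀ f : ℕ → ℂ, MemLpA p f → MemLpA p (cauchyMul φ f)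

/-- The multiplier norm of `φ`, i.e. the operator norm of multiplication by `φ` on `ℓᵖ_A`. -/
def multNorm (p : ℝ) (φ : ℕ → ℂ) : ℝ :=
  sSup { x : ℝ | ∃ f : ℕ → ℂ, MemLpA p f ∧ pNorm p f ≤ 1 ∧ x = pNorm p (cauchyMul φ f) }

/-- The coefficient sequence of the affine polynomial `a + b z`. -/
def affineSeq (a b : ℂ) : ℕ → ℂ :=
  fun n => if n = 0 then a else if n = 1 then b else 0

/-- The coefficient sequence of `z f(z)`. -/
def shiftSeq (f : ℕ → ℂ) : ℕ → ℂ
  | 0 => 0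
  | n + 1 => f n

lemma cauchyMul_affineSeq (a b : ℂ) (f : ℕ → ℂ) (n : ℕ) :
    cauchyMul (affineSeq a b) f n = a * f n + b * shiftSeq f n := by
  cases n with
  | zero => simp [cauchyMul, affineSeq, shiftSeq]
  | succ n =>
    simp only [cauchyMul]
    rw [Finset.sum_range_succ', Finset.sum_range_succ']
    simp [affineSeq, shiftSeq, add_comm]

lemma memLpA_shiftSeq {p : ℝ} {f : ℕ → ℂ} (hf : MemLpA p f) :
    MemLpA p (shiftSeq f) :=
  (summable_nat_add_iff 1).1 hf

lemma pNorm_shiftSeq {p : ℝ} (hp : 0 < p) {f : ℕ → ℂ} (hf : MemLpA p f) :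
    pNorm p (shiftSeq f) = pNorm p f := by
  unfold pNorm
  rw [(memLpA_shiftSeq hf).tsum_eq_zero_add]
  simp [shiftSeq, Real.zero_rpow hp.ne']

lemma summable_const_mul_rpow {p : ℝ} (a : ℂ) {f : ℕ → ℂ} (hf : MemLpA p f) :
    Summable fun k => (‖a‖ * ‖f k‖) ^ p := by
  simp_rw [Real.mul_rpow (norm_nonneg a) (norm_nonneg _)]
  exact hf.mul_left _

lemma tsum_const_mul_rpow {p : ℝ} (hp : 0 < p) (a : ℂ) (f : ℕ → ℂ) :
    (∑' k, (‖a‖ * ‖f k‖) ^ p) ^ (1 / p) = ‖a‖ * pNorm p f := by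
  have h0 : 0 ≤ ∑' k, ‖f k‖ ^ p := tsum_nonneg fun k => by positivity
  simp_rw [Real.mul_rpow (norm_nonneg a) (norm_nonneg _)]
  rw [tsum_mul_left, Real.mul_rpow (by positivity) h0, ← Real.rpow_mul (norm_nonneg a),
    mul_one_div_cancel hp.ne', Real.rpow_one, pNorm]

lemma cauchyMul_affineSeq_bound {p : ℝ} (hp : 1 < p) (a b : ℂ) {f : ℕ → ℂ} (hf : MemLpA p f) :
    MemLpA p (cauchyMul (affineSeq a b) f) ∧
      pNorm p (cauchyMul (affineSeq a b) f) ≤ (‖a‖ + ‖b‖) * pNorm p f := by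
  have hp0 : 0 < p := by linarith
  have hs := memLpA_shiftSeq hf
  obtain ⟨h1, h2⟩ := Real.Lp_add_le_tsum_of_nonneg hp.le
    (f := fun k => ‖a‖ * ‖f k‖) (g := fun k => ‖b‖ * ‖shiftSeq f k‖)
    (fun k => by positivity) (fun k => by positivity)
    (summable_const_mul_rpow a hf) (summable_const_mul_rpow b hs)
  have hle : ∀ k, ‖cauchyMul (affineSeq a b) f k‖ ^ p ≤
      (‖a‖ * ‖f k‖ + ‖b‖ * ‖shiftSeq f k‖) ^ p := fun k => by
    rw [cauchyMul_affineSeq]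
    refine Real.rpow_le_rpow (norm_nonneg _) ((norm_add_le _ _).trans ?_) hp0.le
    simp
  have hm : MemLpA p (cauchyMul (affineSeq a b) f) :=
    h1.of_nonneg_of_le (fun k => by positivity) hle
  refine ⟨hm, ?_⟩
  rw [tsum_const_mul_rpow hp0, tsum_const_mul_rpow hp0, pNorm_shiftSeq hp0 hf, ← add_mul] at h2
  exact (Real.rpow_le_rpow (tsum_nonneg fun k => by positivity) (hm.tsum_le_tsum hle h1)
    (by positivity)).trans h2

lemma isMultiplier_affineSeq {p : ℝ} (hp : 1 < p) (a b : ℂ) :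
    IsMultiplier p (affineSeq a b) :=
  fun _ hf => (cauchyMul_affineSeq_bound hp a b hf).1

lemma pNorm_cauchyMul_affineSeq_le {p : ℝ} (hp : 1 < p) (a b : ℂ) {f : ℕ → ℂ}
    (hf : MemLpA p f) (hf1 : pNorm p f ≤ 1) :
    pNorm p (cauchyMul (affineSeq a b) f) ≤ ‖a‖ + ‖b‖ :=
  (cauchyMul_affineSeq_bound hp a b hf).2.trans (mul_le_of_le_one_right (by positivity) hf1)

lemma multNorm_affineSeq_le {p : ℝ} (hp : 1 < p) (a b : ℂ) :
    multNorm p (affineSeq a b) ≤ ‖a‖ + ‖b‖ := by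
  refine Real.sSup_le ?_ (by positivity)
  rintro _ ⟨f, hf, hf1, rfl⟩
  exact pNorm_cauchyMul_affineSeq_le hp a b hf hf1

lemma pNorm_nonneg (p : ℝ) (f : ℕ → ℂ) : 0 ≤ pNorm p f :=
  Real.rpow_nonneg (tsum_nonneg fun _ => by positivity) _

lemma multNorm_nonneg (p : ℝ) (φ : ℕ → ℂ) : 0 ≤ multNorm p φ := by
  refine Real.sSup_nonneg ?_
  rintro _ ⟨f, -, -, rfl⟩
  exact pNorm_nonneg p _

lemma sum_le_multNorm_affineSeq_rpow {p : ℝ} (hp : 1 < p) (a b : ℂ) {f : ℕ → ℂ}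
    (hf : MemLpA p f) (hf1 : pNorm p f ≤ 1) (s : Finset ℕ) :
    ∑ n ∈ s, ‖a * f n + b * shiftSeq f n‖ ^ p ≤ multNorm p (affineSeq a b) ^ p := by
  have hp0 : 0 < p := by linarith
  have hle : pNorm p (cauchyMul (affineSeq a b) f) ≤ multNorm p (affineSeq a b) := by
    refine le_csSup ⟨‖a‖ + ‖b‖, ?_⟩ ⟨f, hf, hf1, rfl⟩
    rintro _ ⟨g, hg, hg1, rfl⟩
    exact pNorm_cauchyMul_affineSeq_le hp a b hg hg1
  have h0 : 0 ≤ ∑' n, ‖cauchyMul (affineSeq a b) f n‖ ^ p := tsum_nonneg fun k => by positivity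
  have hpow := Real.rpow_le_rpow (pNorm_nonneg p _) hle hp0.le
  rw [pNorm, ← Real.rpow_mul h0, one_div_mul_cancel hp0.ne', Real.rpow_one] at hpow
  simp_rw [← cauchyMul_affineSeq]
  exact ((isMultiplier_affineSeq hp a b f hf).sum_le_tsum s fun k _ => by positivity).trans hpow

lemma norm_le_multNorm_affineSeq {p : ℝ} (hp : 1 < p) (a b : ℂ) :
    ‖a‖ ≤ multNorm p (affineSeq a b) := by
  have hp0 : 0 < p := by linarith
  have hsum : HasSum (fun k => ‖affineSeq 1 0 k‖ ^ p) 1 := by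
    convert hasSum_ite_eq (0 : ℕ) (1 : ℝ) using 2 with k
    by_cases hk : k = 0 <;> simp [affineSeq, hk, Real.zero_rpow hp0.ne']
  have h := sum_le_multNorm_affineSeq_rpow hp a b (f := affineSeq 1 0) hsum.summable
    (by rw [pNorm, hsum.tsum_eq]; simp) {0}
  rw [Finset.sum_singleton] at h
  refine (Real.rpow_le_rpow_iff (norm_nonneg a) (multNorm_nonneg p _) hp0).1 ?_
  simpa [affineSeq, shiftSeq] using h

lemma norm_add_le_multNorm_affineSeq {p : ℝ} (hp : 1 < p) (a b : ℂ) :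
    ‖a + b‖ ≤ multNorm p (affineSeq a b) := by
  have hp0 : 0 < p := by linarith
  refine (Real.rpow_le_rpow_iff (norm_nonneg _) (multNorm_nonneg p _) hp0).1 ?_
  have hN : ∀ N : ℕ, (N : ℝ) / (N + 1) * ‖a + b‖ ^ p ≤ multNorm p (affineSeq a b) ^ p := by
    intro N
    have hN0 : (0 : ℝ) < (N : ℝ) + 1 := by positivity
    set t : ℝ := ((N : ℝ) + 1) ^ (-(1 / p)) with ht
    have ht0 : 0 < t := Real.rpow_pos_of_pos hN0 _
    have htp : t ^ p = 1 / (N + 1) := by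
      rw [ht, ← Real.rpow_mul hN0.le, neg_mul, one_div_mul_cancel hp0.ne', Real.rpow_neg_one,
        one_div]
    set f : ℕ → ℂ := fun k => if k < N + 1 then (t : ℂ) else 0 with hf
    have hsum : HasSum (fun k => ‖f k‖ ^ p) 1 := by
      have h := hasSum_sum_of_ne_finset_zero (L := .unconditional ℕ) (f := fun k => ‖f k‖ ^ p) (s := Finset.range (N + 1))
        (fun k hk => by
          have hk' : ¬ k < N + 1 := by simpa using hk
          simp only [hf, if_neg hk', norm_zero, Real.zero_rpow hp0.ne'])
      convert h using 1
      rw [Finset.sum_congr rfl (g := fun _ => t ^ p) (fun k hk => by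
          have hk' : k < N + 1 := Finset.mem_range.1 hk
          simp only [hf, if_pos hk', Complex.norm_real, Real.norm_of_nonneg ht0.le])]
      rw [Finset.sum_const, Finset.card_range, htp, nsmul_eq_mul]
      push_cast
      field_simp
    have h := sum_le_multNorm_affineSeq_rpow hp a b (f := f) hsum.summable
      (by rw [pNorm, hsum.tsum_eq]; simp) ((Finset.range N).map (addRightEmbedding 1))
    rw [Finset.sum_map, Finset.sum_congr rfl (g := fun _ => ‖a + b‖ ^ p * t ^ p) (fun k hk => by
        have hk' : k < N := Finset.mem_range.1 hk
        have h1 : f (k + 1) = t := if_pos (by omega)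
        have h2 : f k = t := if_pos (by omega)
        simp only [addRightEmbedding_apply, shiftSeq, h1, h2]
        rw [← add_mul, norm_mul, Complex.norm_real, Real.norm_of_nonneg ht0.le,
          Real.mul_rpow (norm_nonneg _) ht0.le]),
      Finset.sum_const, Finset.card_range, htp, nsmul_eq_mul] at h
    refine le_of_eq_of_le ?_ h
    ring
  have hlim := (tendsto_natCast_div_add_atTop (1 : ℝ)).mul_const (‖a + b‖ ^ p)
  rw [one_mul] at hlim
  exact le_of_tendsto' hlim hN

/-- `𝓜_p` fails the upper Pythagorean inequality for every `r > 1` and `K > 0`; witnesses are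
`x = 1` and `y = cz` for suitable `c ≠ 0`. -/
theorem multiplier_space_fails_upper_pythagoras (p : ℝ) (hp : 1 < p)
    (r K : ℝ) (hr : 1 < r) (hK : 0 < K) :
    ∃ x y : ℕ → ℂ, IsMultiplier p x ∧ IsMultiplier p y ∧
      (∃ c : ℂ, c ≠ 0 ∧
        x = (fun n => if n = 0 then (1 : ℂ) else 0) ∧
        y = (fun n => if n = 1 then c else 0)) ∧
      (∀ β : ℂ, multNorm p x ≤ multNorm p (fun n => x n + β * y n)) ∧
      multNorm p x ^ r + K * multNorm p y ^ r < multNorm p (fun n => x n + y n) ^ r := by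
  have hr0 : 0 < r - 1 := by linarith
  obtain ⟨c, hc, hcr⟩ : ∃ c : ℝ, 0 < c ∧ K * c ^ r < r * c := by
    have hq : 0 < r / (2 * K) := by positivity
    refine ⟨(r / (2 * K)) ^ (1 / (r - 1)), by positivity, ?_⟩
    set c := (r / (2 * K)) ^ (1 / (r - 1)) with hcdef
    have hc : 0 < c := by positivity
    have h1 : c ^ (r - 1) = r / (2 * K) := by
      rw [hcdef, ← Real.rpow_mul hq.le, one_div_mul_cancel hr0.ne', Real.rpow_one]
    have h2 : c ^ r = r / (2 * K) * c := by
      rw [← h1, ← Real.rpow_add_one hc.ne', sub_add_cancel]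
    have h3 : K * c ^ r = r * c / 2 := by
      rw [h2]; field_simp
    have : 0 < r * c := by positivity
    linarith
  have hadd : ∀ β : ℂ, (fun n => affineSeq 1 0 n + β * affineSeq 0 c n) = affineSeq 1 (β * c) := by
    intro β
    funext n
    rcases n with _ | _ | n <;> simp [affineSeq]
  have hx : multNorm p (affineSeq 1 0) ≤ 1 := by
    simpa using multNorm_affineSeq_le hp 1 0
  have hy : multNorm p (affineSeq 0 c) ≤ c := by
    simpa [abs_of_pos hc] using multNorm_affineSeq_le hp 0 c
  refine ⟨affineSeq 1 0, affineSeq 0 c, isMultiplier_affineSeq hp _ _,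
    isMultiplier_affineSeq hp _ _, ⟨c, by exact_mod_cast hc.ne', ?_, ?_⟩, fun β => ?_, ?_⟩
  · funext n
    simp [affineSeq]
  · funext n
    rcases n with _ | n <;> simp [affineSeq]
  · rw [hadd]
    exact hx.trans (by simpa using norm_le_multNorm_affineSeq hp 1 (β * c))
  · have hsum : 1 + c ≤ multNorm p (fun n => affineSeq 1 0 n + affineSeq 0 c n) := by
      have h := norm_add_le_multNorm_affineSeq hp 1 (1 * c)
      rw [← hadd] at h
      have hn : ‖(1 : ℂ) + 1 * c‖ = 1 + c := by
        rw [one_mul, ← Complex.ofReal_one, ← Complex.ofReal_add, Complex.norm_real,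
          Real.norm_of_nonneg (by positivity)]
      rw [hn] at h
      simpa only [one_mul] using h
    calc multNorm p (affineSeq 1 0) ^ r + K * multNorm p (affineSeq 0 c) ^ r
        ≤ 1 ^ r + K * c ^ r := by
          gcongr <;> exact multNorm_nonneg _ _
      _ < 1 + r * c := by rw [Real.one_rpow]; linarith
      _ ≤ (1 + c) ^ r := one_add_mul_self_le_rpow_one_add (by linarith) hr.le
      _ ≤ _ := by gcongr
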